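/- As the real variable x tends to infinity, cos(π/(2x) + δ₀(x)/2) − cos(π/x − (1/2)·arcsin((1/2)·sin(2π/x))) − π⁴/(8x⁴) + π⁵/(4x⁵) = O(1/x⁶); that is, the width of the polygon D_x exceeds the width of the polygon B_x by π⁴/(8x⁴) − π⁵/(4x⁵) + O(1/x⁶). -/

import Mathlib

open Real Filter Asymptotics

/-- `δ₀(x) = arctan(tan(2π/x)·tan(π/x)) − arcsin(sin(2π/x)·sin(π/x) / √(4·sin(π/x)² + cos(4π/x)))`. -/
noncomputable def δ₀ (x : ℝ) : ℝ :=
  Real.arctan (Real.tan (2 * π / x) * Real.tan (π / x)) -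
    Real.arcsin (Real.sin (2 * π / x) * Real.sin (π / x) /
      Real.sqrt (4 * Real.sin (π / x) ^ 2 + Real.cos (4 * π / x)))

/-- `δ_B(x) = π/x − arcsin((1/2)·sin(2π/x))`. -/
noncomputable def δB (x : ℝ) : ℝ :=
  π / x - Real.arcsin ((1 / 2) * Real.sin (2 * π / x))

open scoped Topology

theorem sin_sub_self_isBigO : (fun t : ℝ => sin t - t) =O[𝓝 0] fun t => t ^ 3 := by
  refine IsBigO.of_bound 1 ?_
  filter_upwards [Metric.closedBall_mem_nhds (0 : ℝ) one_pos] with t ht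
  have ht1 : |t| ≤ 1 := by simpa using ht
  have h := abs_le.1 (sin_bound ht1)
  have h5 : |t| ^ 5 ≤ |t| ^ 3 := pow_le_pow_of_le_one (abs_nonneg t) ht1 (by norm_num)
  have h3 := abs_le.1 (abs_pow t 3).le
  rw [norm_eq_abs, norm_eq_abs, abs_pow, one_mul, abs_le]
  have h0 : 0 ≤ |t| ^ 3 := by positivity
  constructor <;> linarith

theorem cos_sub_one_add_isBigO :
    (fun t : ℝ => cos t - 1 + t ^ 2 / 2) =O[𝓝 0] fun t => t ^ 4 := by
  refine IsBigO.of_bound 1 ?_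
  filter_upwards [Metric.closedBall_mem_nhds (0 : ℝ) one_pos] with t ht
  have ht1 : |t| ≤ 1 := by simpa using ht
  have h := abs_le.1 (cos_bound ht1)
  have h4 : 0 ≤ |t| ^ 4 := by positivity
  rw [norm_eq_abs, norm_eq_abs, abs_pow, one_mul, abs_le]
  constructor <;> linarith

theorem isBigO_pow_of_le {m n : ℕ} (h : m ≤ n) :
    (fun t : ℝ => t ^ n) =O[𝓝 0] fun t => t ^ m := by
  rcases h.eq_or_lt with rfl | h
  · exact isBigO_refl _ _
  · exact (isLittleO_pow_pow h).isBigO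

theorem cos_sub_one_isBigO : (fun t : ℝ => cos t - 1) =O[𝓝 0] fun t => t ^ 2 := by
  have h := (cos_sub_one_add_isBigO.trans (isBigO_pow_of_le (m := 2) (by norm_num))).sub
    ((isBigO_refl (fun t : ℝ => t ^ 2) (𝓝 0)).const_mul_left (1 / 2))
  exact h.congr_left fun t => by ring

section Composition

variable {p : ℝ → ℝ} {n : ℕ}

theorem tendsto_zero_of_isBigO_pow (hn : n ≠ 0) (hp : p =O[𝓝 0] fun t : ℝ => t ^ n) :
    Tendsto p (𝓝 0) (𝓝 0) := by
  refine hp.trans_tendsto ?_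
  simpa [hn] using (continuous_pow n).tendsto (0 : ℝ)

theorem sin_comp_sub_self_isBigO (hn : n ≠ 0) (hp : p =O[𝓝 0] fun t : ℝ => t ^ n) :
    (fun t => sin (p t) - p t) =O[𝓝 0] fun t => t ^ (n * 3) := by
  simpa only [pow_mul, Function.comp_def] using
    (sin_sub_self_isBigO.comp_tendsto (tendsto_zero_of_isBigO_pow hn hp)).trans (hp.pow 3)

theorem cos_comp_sub_one_isBigO (hn : n ≠ 0) (hp : p =O[𝓝 0] fun t : ℝ => t ^ n) :
    (fun t => cos (p t) - 1) =O[𝓝 0] fun t => t ^ (n * 2) := by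
  simpa only [pow_mul, Function.comp_def] using
    (cos_sub_one_isBigO.comp_tendsto (tendsto_zero_of_isBigO_pow hn hp)).trans (hp.pow 2)

theorem arcsin_sub_isBigO {z : ℝ → ℝ} {l : Filter ℝ} (hz : Tendsto z l (𝓝 0))
    (hp : Tendsto p l (𝓝 0)) :
    (fun t => arcsin (z t) - p t) =O[l] fun t => z t - sin (p t) := by
  have h := (hasStrictDerivAt_arcsin (x := 0) (by norm_num) (by norm_num)).isBigO_sub
  have hs : Tendsto (fun t => sin (p t)) l (𝓝 0) := by
    simpa [Function.comp_def] using (continuous_sin.tendsto 0).comp hp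
  have h2 : Tendsto (fun t => (z t, sin (p t))) l (𝓝 ((0 : ℝ), (0 : ℝ))) := hz.prodMk_nhds hs
  refine (h.comp_tendsto h2).congr' ?_ EventuallyEq.rfl
  filter_upwards [hp (Icc_mem_nhds (neg_lt_zero.2 pi_div_two_pos) pi_div_two_pos)] with t ht
  simp only [Function.comp_apply]
  rw [arcsin_sin ht.1 ht.2]

theorem cos_half_add_isBigO (hp : p =O[𝓝 0] fun t : ℝ => t ^ 3) :
    (fun t => cos (t / 2 + p t) - cos (t / 2) + t / 2 * p t) =O[𝓝 0] fun t => t ^ 6 := by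
  have hhalf : (fun t : ℝ => t / 2) =O[𝓝 0] fun t => t ^ 1 :=
    ((isBigO_refl (fun t : ℝ => t) (𝓝 0)).const_mul_left (1 / 2)).congr
      (fun t => by ring) (fun t => by ring)
  have hc : (fun t : ℝ => cos (t / 2)) =O[𝓝 0] fun _ => (1 : ℝ) :=
    IsBigO.of_bound 1 (.of_forall fun t => by simpa using abs_cos_le_one (t / 2))
  have hs : (fun t : ℝ => sin (p t)) =O[𝓝 0] fun t => t ^ 3 :=
    (((sin_comp_sub_self_isBigO (by norm_num) hp).trans (isBigO_pow_of_le (by norm_num))).add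
      hp).congr_left fun t => by ring
  have h1 := (hc.mul (cos_comp_sub_one_isBigO (by norm_num) hp)).congr_right
    (g₂ := fun t => t ^ 6) fun t => by ring
  have h2 := ((sin_comp_sub_self_isBigO (by norm_num) hhalf).mul hs).congr_right
    (g₂ := fun t => t ^ 6) fun t => by ring
  have h3 := ((hhalf.mul (sin_comp_sub_self_isBigO (by norm_num) hp)).congr_right
    (g₂ := fun t => t ^ 10) fun t => by ring).trans (isBigO_pow_of_le (m := 6) (by norm_num))
  exact ((h1.sub h2).sub h3).congr_left fun t => by rw [cos_add]; ring

end Composition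

theorem id_isBigO_pow_one : (fun t : ℝ => t) =O[𝓝 0] fun t => t ^ 1 :=
  (isBigO_refl (fun t : ℝ => t) (𝓝 0)).congr_right fun t => (pow_one t).symm

theorem sin_isBigO : (fun t : ℝ => sin t) =O[𝓝 0] fun t => t ^ 1 :=
  ((sin_sub_self_isBigO.trans (isBigO_pow_of_le (by norm_num))).add
    id_isBigO_pow_one).congr_left fun t => by ring

theorem arcsin_half_sin_two_mul_isBigO :
    (fun t : ℝ => arcsin (1 / 2 * sin (2 * t)) - (t - t ^ 3 / 2)) =O[𝓝 0] fun t => t ^ 5 := by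
  have hz : Tendsto (fun t : ℝ => 1 / 2 * sin (2 * t)) (𝓝 0) (𝓝 0) :=
    Continuous.tendsto' (by fun_prop) _ _ (by simp)
  have hp : Tendsto (fun t : ℝ => t - t ^ 3 / 2) (𝓝 0) (𝓝 0) :=
    Continuous.tendsto' (by fun_prop) _ _ (by simp)
  refine (arcsin_sub_isBigO hz hp).trans ?_
  have hq : (fun t : ℝ => t ^ 3 / 2) =O[𝓝 0] fun t => t ^ 3 :=
    ((isBigO_refl (fun t : ℝ => t ^ 3) (𝓝 0)).const_mul_left (1 / 2)).congr_left fun t => by ring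
  have hc : (fun t : ℝ => cos t) =O[𝓝 0] fun _ => (1 : ℝ) :=
    IsBigO.of_bound 1 (.of_forall fun t => by simpa using abs_cos_le_one t)
  have h1 := (sin_isBigO.mul cos_sub_one_add_isBigO).congr_right
    (g₂ := fun t => t ^ 5) fun t => by ring
  have h2 := (sin_sub_self_isBigO.mul (isBigO_refl (fun t : ℝ => t ^ 2) (𝓝 0))).congr_right
    (g₂ := fun t => t ^ 5) fun t => by ring
  have h3 := ((sin_isBigO.mul (cos_comp_sub_one_isBigO (by norm_num) hq)).congr_right
    (g₂ := fun t => t ^ 7) fun t => by ring).trans (isBigO_pow_of_le (m := 5) (by norm_num))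
  have h4 := ((hc.mul (sin_comp_sub_self_isBigO (by norm_num) hq)).congr_right
    (g₂ := fun t => t ^ 9) fun t => by ring).trans (isBigO_pow_of_le (m := 5) (by norm_num))
  have h5 := (cos_sub_one_isBigO.mul hq).congr_right (g₂ := fun t => t ^ 5) fun t => by ring
  refine ((((h1.sub (h2.const_mul_left (1 / 2))).sub h3).add h4).add h5).congr_left fun t => ?_
  rw [sin_sub, sin_two_mul]
  ring

theorem tan_isBigO : (fun t : ℝ => tan t) =O[𝓝 0] fun t => t ^ 1 := by
  have h := (hasDerivAt_tan (x := 0) (by simp)).isBigO_sub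
  exact h.congr (fun t => by simp) fun t => by simp

theorem tan_two_mul_mul_tan_isBigO :
    (fun t : ℝ => tan (2 * t) * tan t) =O[𝓝 0] fun t => t ^ 2 := by
  have h0 : Tendsto (fun t : ℝ => 2 * t) (𝓝 0) (𝓝 0) :=
    Continuous.tendsto' (by fun_prop) _ _ (by simp)
  have h1 : (fun t : ℝ => tan (2 * t)) =O[𝓝 0] fun t => t ^ 1 :=
    (tan_isBigO.comp_tendsto h0).trans
      ((id_isBigO_pow_one.const_mul_left 2).congr_left fun t => by simp)
  exact (h1.mul tan_isBigO).congr_right fun t => by ring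

theorem eventually_cos_mul_pos (c : ℝ) : ∀ᶠ t : ℝ in 𝓝 0, 0 < cos (c * t) := by
  have h : Tendsto (fun t : ℝ => cos (c * t)) (𝓝 0) (𝓝 1) :=
    Continuous.tendsto' (by fun_prop) _ _ (by simp)
  exact h.eventually (lt_mem_nhds one_pos)

theorem tan_two_mul_mul_tan_sub_isBigO :
    (fun t : ℝ => tan (2 * t) * tan t - 2 * t ^ 2) =O[𝓝 0] fun t => t ^ 4 := by
  have h2 : (fun t : ℝ => 2 * t) =O[𝓝 0] fun t => t ^ 1 := id_isBigO_pow_one.const_mul_left 2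
  have hc : (fun t : ℝ => cos (2 * t)) =O[𝓝 0] fun _ => (1 : ℝ) :=
    IsBigO.of_bound 1 (.of_forall fun t => by simpa using abs_cos_le_one (2 * t))
  have h1 := ((sin_comp_sub_self_isBigO (by norm_num) h2).mul sin_isBigO).congr_right
    (g₂ := fun t => t ^ 4) fun t => by ring
  have h3 := (h2.mul sin_sub_self_isBigO).congr_right (g₂ := fun t => t ^ 4) fun t => by ring
  have h4 := (tan_two_mul_mul_tan_isBigO.mul
    (cos_comp_sub_one_isBigO (by norm_num) h2)).congr_right (g₂ := fun t => t ^ 4)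
      fun t => by ring
  have h5 := ((tan_two_mul_mul_tan_isBigO.mul hc).mul cos_sub_one_isBigO).congr_right
    (g₂ := fun t => t ^ 4) fun t => by ring
  refine (((h1.add h3).sub h4).sub h5).congr' ?_ EventuallyEq.rfl
  filter_upwards [eventually_cos_mul_pos 1, eventually_cos_mul_pos 2] with t ht1 ht2
  rw [one_mul] at ht1
  rw [tan_eq_sin_div_cos, tan_eq_sin_div_cos]
  field_simp
  ring

theorem arctan_tan_two_mul_mul_tan_isBigO :
    (fun t : ℝ => arctan (tan (2 * t) * tan t)) =O[𝓝 0] fun t => t ^ 2 := by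
  have h := (hasDerivAt_arctan 0).isBigO_sub
  have h' : arctan =O[𝓝 0] fun t : ℝ => t := h.congr (fun t => by simp) fun t => by simp
  exact (h'.comp_tendsto (tendsto_zero_of_isBigO_pow (by norm_num)
    tan_two_mul_mul_tan_isBigO)).trans tan_two_mul_mul_tan_isBigO

theorem sin_arctan_tan_two_mul_mul_tan_isBigO :
    (fun t : ℝ => sin (arctan (tan (2 * t) * tan t)) - 2 * t ^ 2) =O[𝓝 0] fun t => t ^ 4 := by
  have h1 := ((tan_two_mul_mul_tan_isBigO.mul (cos_comp_sub_one_isBigO (by norm_num)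
    arctan_tan_two_mul_mul_tan_isBigO)).congr_right (g₂ := fun t => t ^ 6)
      fun t => by ring).trans (isBigO_pow_of_le (m := 4) (by norm_num))
  refine (h1.add tan_two_mul_mul_tan_sub_isBigO).congr_left fun t => ?_
  rw [sin_arctan, cos_arctan]
  ring

theorem arcsin_argument_eq :
    ∀ᶠ t : ℝ in 𝓝 0, sin (2 * t) * sin t / √(4 * sin t ^ 2 + cos (4 * t)) =
      sin (arctan (tan (2 * t) * tan t)) * cos t := by
  filter_upwards [eventually_cos_mul_pos 1, eventually_cos_mul_pos 2] with t ht1 ht2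
  rw [one_mul] at ht1
  have hcos : 4 * sin t ^ 2 + cos (4 * t) =
      (1 + (tan (2 * t) * tan t) ^ 2) * cos (2 * t) ^ 2 := by
    rw [show 4 * t = 2 * (2 * t) by ring, cos_two_mul (2 * t), tan_eq_sin_div_cos,
      tan_eq_sin_div_cos]
    field_simp
    rw [sin_two_mul, cos_two_mul, mul_pow, mul_pow, sin_sq]
    ring
  rw [hcos, sqrt_mul (by positivity), sqrt_sq ht2.le, sin_arctan]
  have hpos : 0 < √(1 + (tan (2 * t) * tan t) ^ 2) := by positivity
  generalize √(1 + (tan (2 * t) * tan t) ^ 2) = r at hpos ⊢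
  rw [tan_eq_sin_div_cos, tan_eq_sin_div_cos]
  field_simp

theorem arctan_sub_arcsin_isBigO :
    (fun t : ℝ => arctan (tan (2 * t) * tan t) -
      arcsin (sin (2 * t) * sin t / √(4 * sin t ^ 2 + cos (4 * t))) - t ^ 4)
      =O[𝓝 0] fun t => t ^ 5 := by
  have hA := arctan_tan_two_mul_mul_tan_isBigO
  have hA0 := tendsto_zero_of_isBigO_pow (by norm_num) hA
  have hz : Tendsto (fun t : ℝ => sin (2 * t) * sin t / √(4 * sin t ^ 2 + cos (4 * t)))
      (𝓝 0) (𝓝 0) := by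
    have h : ContinuousAt
        (fun t : ℝ => sin (2 * t) * sin t / √(4 * sin t ^ 2 + cos (4 * t))) 0 :=
      ContinuousAt.div (by fun_prop) (by fun_prop) (by simp)
    simpa using h.tendsto
  have hq := isBigO_refl (fun t : ℝ => t ^ 4) (𝓝 0)
  have hp : Tendsto (fun t : ℝ => arctan (tan (2 * t) * tan t) - t ^ 4) (𝓝 0) (𝓝 0) := by
    simpa using hA0.sub (tendsto_zero_of_isBigO_pow (by norm_num) hq)
  have main := arcsin_sub_isBigO hz hp
  have hsA : (fun t : ℝ => sin (arctan (tan (2 * t) * tan t))) =O[𝓝 0] fun t => t ^ 2 :=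
    ((sin_arctan_tan_two_mul_mul_tan_isBigO.trans (isBigO_pow_of_le (by norm_num))).add
      ((isBigO_refl (fun t : ℝ => t ^ 2) (𝓝 0)).const_mul_left 2)).congr_left fun t => by ring
  have hcA : (fun t : ℝ => cos (arctan (tan (2 * t) * tan t))) =O[𝓝 0] fun _ => (1 : ℝ) :=
    IsBigO.of_bound 1 (.of_forall fun t => by simpa using abs_cos_le_one _)
  have h1 := ((hsA.mul cos_sub_one_add_isBigO).congr_right
    (g₂ := fun t => t ^ 6) fun t => by ring).trans (isBigO_pow_of_le (m := 5) (by norm_num))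
  have h2 := ((sin_arctan_tan_two_mul_mul_tan_isBigO.mul
    (isBigO_refl (fun t : ℝ => t ^ 2) (𝓝 0))).congr_right
    (g₂ := fun t => t ^ 6) fun t => by ring).trans (isBigO_pow_of_le (m := 5) (by norm_num))
  have h3 := ((hsA.mul (cos_comp_sub_one_isBigO (by norm_num) hq)).congr_right
    (g₂ := fun t => t ^ 10) fun t => by ring).trans (isBigO_pow_of_le (m := 5) (by norm_num))
  have h4 := ((hcA.mul (sin_comp_sub_self_isBigO (by norm_num) hq)).congr_right
    (g₂ := fun t => t ^ 12) fun t => by ring).trans (isBigO_pow_of_le (m := 5) (by norm_num))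
  have h5 := (((cos_comp_sub_one_isBigO (by norm_num) hA).mul hq).congr_right
    (g₂ := fun t => t ^ 8) fun t => by ring).trans (isBigO_pow_of_le (m := 5) (by norm_num))
  have hsum := (((h1.sub (h2.const_mul_left (1 / 2))).sub h3).add h4).add h5
  refine ((main.trans (hsum.congr' ?_ EventuallyEq.rfl)).neg_left).congr_left fun t => by ring
  filter_upwards [arcsin_argument_eq] with t ht
  rw [ht, sin_sub]
  ring

theorem cos_half_add_sub_cos_isBigO :
    (fun t : ℝ => cos (t / 2 + (arctan (tan (2 * t) * tan t) -
        arcsin (sin (2 * t) * sin t / √(4 * sin t ^ 2 + cos (4 * t)))) / 2)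
      - cos (t - 1 / 2 * arcsin (1 / 2 * sin (2 * t))) - t ^ 4 / 8 + t ^ 5 / 4)
      =O[𝓝 0] fun t => t ^ 6 := by
  have hδ := arctan_sub_arcsin_isBigO
  set δ : ℝ → ℝ := fun t => arctan (tan (2 * t) * tan t) -
    arcsin (sin (2 * t) * sin t / √(4 * sin t ^ 2 + cos (4 * t))) with hδ_def
  have hα := arcsin_half_sin_two_mul_isBigO
  set α : ℝ → ℝ := fun t => arcsin (1 / 2 * sin (2 * t)) with hα_def
  change (fun t => δ t - t ^ 4) =O[𝓝 0] _ at hδ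
  change (fun t => α t - (t - t ^ 3 / 2)) =O[𝓝 0] _ at hα
  have hp : (fun t => δ t / 2) =O[𝓝 0] fun t => t ^ 3 :=
    (((hδ.trans (isBigO_pow_of_le (by norm_num))).add
      (isBigO_pow_of_le (m := 3) (n := 4) (by norm_num))).const_mul_left (1 / 2)).congr_left
        fun t => by ring
  have hq : (fun t => (t - α t) / 2) =O[𝓝 0] fun t => t ^ 3 :=
    (((hα.trans (isBigO_pow_of_le (by norm_num))).const_mul_left (-(1 / 2))).add
      ((isBigO_refl (fun t : ℝ => t ^ 3) (𝓝 0)).const_mul_left (1 / 4))).congr_left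
        fun t => by ring
  have h1 := (id_isBigO_pow_one.mul hδ).congr_right (g₂ := fun t => t ^ 6) fun t => by ring
  have h2 := (id_isBigO_pow_one.mul hα).congr_right (g₂ := fun t => t ^ 6) fun t => by ring
  refine ((((cos_half_add_isBigO hp).sub (cos_half_add_isBigO hq)).sub
    (h1.const_mul_left (1 / 4))).sub (h2.const_mul_left (1 / 4))).congr_left fun t => ?_
  rw [show t - 1 / 2 * arcsin (1 / 2 * sin (2 * t)) = t / 2 + (t - α t) / 2 by
    simp only [hα_def]; ring]
  simp only [hδ_def]
  ring


theorem width_Dn_exceeds_Bn_isBigO :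
    (fun x : ℝ => Real.cos (π / (2 * x) + δ₀ x / 2)
        - Real.cos (π / x - (1 / 2) * Real.arcsin ((1 / 2) * Real.sin (2 * π / x)))
        - π ^ 4 / (8 * x ^ 4) + π ^ 5 / (4 * x ^ 5))
      =O[atTop] (fun x : ℝ => 1 / x ^ 6) := by
  have hx : Tendsto (fun x : ℝ => π / x) atTop (𝓝 0) := tendsto_const_nhds.div_atTop tendsto_id
  have h := cos_half_add_sub_cos_isBigO.comp_tendsto hx
  have h6 : ((fun t : ℝ => t ^ 6) ∘ fun x : ℝ => π / x) =O[atTop] fun x : ℝ => 1 / x ^ 6 :=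
    ((isBigO_refl (fun x : ℝ => 1 / x ^ 6) atTop).const_mul_left (π ^ 6)).congr_left
      fun x => by simp only [Function.comp_apply, div_pow]; ring
  refine (h.trans h6).congr_left fun x => ?_
  simp only [Function.comp_apply, δ₀, mul_div_assoc]
  rw [show π / (2 * x) = π / x / 2 by rw [div_div, mul_comm]]
  simp only [div_pow, div_div, mul_comm (x ^ _)]
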